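/- If n is odd and p is a prime with p ≡ 3 (mod 4) dividing the Pell number P_n, then a contradiction arises; i.e., every odd prime divisor p of P_n for odd n satisfies p ≡ 1 (mod 4). -/

import Mathlib

def pellP : ℕ → ℕ
  | 0 => 0
  | 1 => 1
  | n + 2 => 2 * pellP (n + 1) + pellP n

def pellQ : ℕ → ℕ
  | 0 => 1
  | 1 => 1
  | n + 2 => 2 * pellQ (n + 1) + pellQ n

theorem pell_succ (n : ℕ) :
    pellP (n + 1) = pellP n + pellQ n ∧ pellQ (n + 1) = 2 * pellP n + pellQ n := by
  induction n with
  | zero => simp [pellP, pellQ]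
  | succ n ih =>
    simp only [pellP, pellQ]
    omega

theorem pellQ_sq_sub_two_mul_pellP_sq (n : ℕ) :
    (pellQ n : ℤ) ^ 2 - 2 * (pellP n : ℤ) ^ 2 = (-1) ^ n := by
  induction n with
  | zero => simp [pellP, pellQ]
  | succ n ih =>
    rw [(pell_succ n).1, (pell_succ n).2, pow_succ (-1), ← ih]
    push_cast
    ring

theorem pellP_odd_prime_divisor_mod_four (n p : ℕ) (hn : Odd n) (hp : p.Prime)
    (hodd : Odd p) (hdvd : p ∣ pellP n) : p % 4 = 1 := by
  have : Fact p.Prime := ⟨hp⟩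
  have hP : (pellP n : ZMod p) = 0 := (ZMod.natCast_eq_zero_iff _ _).2 hdvd
  have hQ : (pellQ n : ZMod p) ^ 2 = -1 := by
    have h := congrArg (Int.cast : ℤ → ZMod p) (pellQ_sq_sub_two_mul_pellP_sq n)
    push_cast at h
    simpa [hP, hn.neg_one_pow] using h
  have h3 := ZMod.mod_four_ne_three_of_sq_eq_neg_one hQ
  have h2 := Nat.odd_iff.1 hodd
  omega
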